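/- Let λ ≥ 0 and assume either (a) L̄'_r(λ⁺) > −∞ and L̄'_r(λ⁺) is a limit point of {L̄'_r(t) : t > λ}, or (b) λ = 0, L̄'_r(0⁺) = −∞ and lim_{t→0⁺} L̄(t) = 0. Suppose in addition that there is a sequence (t_i) in (λ̃, +∞) converging to λ̃ such that for each i the limit L(t_i) = lim_α c_α·log ∫_ℝ exp(t_i·x/c_α) dμ_α(x) exists (i.e. the upper limit defining L̄(t_i) is a limit), where λ̃ := sup{t > λ : L̄ is affine on (λ, t]}. Then for every net (x_α, y_α) in [-∞,+∞]² with (x_α) converging to L̄'_r(λ⁺) and liminf_α y_α > L̄'_r(λ⁺), the nets (c_α·log μ_α([x_α, y_α])) and (c_α·log μ_α((x_α, y_α))) converge, with common limit L̄(λ⁺) − λ·L̄'_r(λ⁺). -/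

import Mathlib

open Filter MeasureTheory Set Topology

noncomputable section

/-- `c · log m` as an extended real number, where `m ∈ [0,∞]`. -/
def elog (c : ℝ) (m : ENNReal) : EReal := (c : EReal) * ENNReal.log m

/-- The generalized log-moment generating function `L̄` associated with the net
`(μ_α, c_α)` indexed by the filter `lf`:
`L̄(t) = limsup_α c_α · log ∫ exp(t·x/c_α) dμ_α(x)`. -/
def genLogMGF {ι : Type*} (lf : Filter ι) (μ : ι → Measure ℝ) (c : ι → ℝ) (t : ℝ) : EReal :=
  Filter.limsup
    (fun i => elog (c i) (∫⁻ x : ℝ, ENNReal.ofReal (Real.exp (t * x / c i)) ∂ (μ i))) lf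

/-- Legendre–Fenchel transform of an `EReal`-valued function on `ℝ`, evaluated at an
extended real argument: `L*(x) = sup_t (t·x − L(t))`. -/
def LegendreEE (L : ℝ → EReal) (x : EReal) : EReal := ⨆ t : ℝ, ((t : EReal) * x - L t)

open Classical in
/-- The right derivative of a convex `EReal`-valued function at `t`, with the conventions
`L'_r(t) = +∞` when `L(s) = +∞` for all `s > t` and `L'_r(t) = -∞` when `L(s) = -∞` for
some `s > t`; otherwise it is the infimum of the right difference quotients. -/
def rightDerivE (L : ℝ → EReal) (t : ℝ) : EReal :=
  if ∀ s : ℝ, t < s → L s = ⊤ then ⊤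
  else if ∃ s : ℝ, t < s ∧ L s = ⊥ then ⊥
  else ⨅ s ∈ Set.Ioi t, (L s - L t) * (((s - t)⁻¹ : ℝ) : EReal)

/-- The left derivative of a convex `EReal`-valued function at `t` (supremum of left
difference quotients). -/
def leftDerivE (L : ℝ → EReal) (t : ℝ) : EReal :=
  ⨆ s ∈ Set.Iio t, (L t - L s) * (((t - s)⁻¹ : ℝ) : EReal)

/-- Right limit at `a` of an `EReal`-valued function (as a `limsup`; it coincides with
`lim_{t→a⁺} f(t)` whenever the latter exists, e.g. for monotone or convex `f`). -/
def rightLimE (f : ℝ → EReal) (a : ℝ) : EReal := Filter.limsup f (nhdsWithin a (Set.Ioi a))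

/-- Left limit at `a` of an `EReal`-valued function (as a `limsup`; it coincides with
`lim_{t→a⁻} f(t)` whenever the latter exists). -/
def leftLimE (f : ℝ → EReal) (a : ℝ) : EReal := Filter.limsup f (nhdsWithin a (Set.Iio a))

/-- `L` is affine on the interval `(a, b]`. -/
def AffineOnIoc (L : ℝ → EReal) (a b : ℝ) : Prop :=
  ∃ p q : ℝ, ∀ s ∈ Set.Ioc a b, L s = ((p * s + q : ℝ) : EReal)

/-- `λ̃ = sup {t > λ : L is affine on (λ, t]}` (equal to `λ` if there is no such `t`). -/
def tildeOf (L : ℝ → EReal) (lam : ℝ) : ℝ :=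
  sSup (insert lam {t : ℝ | lam < t ∧ AffineOnIoc L lam t})

/-- Differentiability at `t` of an `EReal`-valued function: `L(t)` is finite and the
difference quotients converge to a (finite) real number. -/
def EDifferentiableAt (L : ℝ → EReal) (t : ℝ) : Prop :=
  (∃ r : ℝ, L t = (r : EReal)) ∧
  ∃ d : ℝ, Filter.Tendsto (fun s => (L s - L t) * (((s - t)⁻¹ : ℝ) : EReal))
    (nhdsWithin t {t}ᶜ) (nhds (d : EReal))

/-- The function `l₀(x) = − lim_{ε→0⁺} limsup_α c_α · log μ_α((x−ε, x+ε))` (the limit over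
`ε` exists by monotonicity and equals the infimum). -/
def l0fun {ι : Type*} (lf : Filter ι) (μ : ι → Measure ℝ) (c : ι → ℝ) (x : ℝ) : EReal :=
  - ⨅ ε ∈ Set.Ioi (0:ℝ),
      Filter.limsup (fun i => elog (c i) (μ i (Set.Ioo (x - ε) (x + ε)))) lf

/-- `L` restricted to `[0,∞)` is proper: `(−∞,+∞]`-valued with at least one finite value. -/
def LbarProper (L : ℝ → EReal) : Prop :=
  (∀ t : ℝ, 0 ≤ t → L t ≠ ⊥) ∧ ∃ t : ℝ, 0 ≤ t ∧ L t ≠ ⊤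

/-- `μ([x, y])` for extended-real endpoints `x, y`, with `μ` regarded as a measure on
`[-∞, +∞]`. -/
def muIccE (μ : Measure ℝ) (x y : EReal) : ENNReal :=
  μ {z : ℝ | x ≤ (z : EReal) ∧ (z : EReal) ≤ y}

/-- `μ((x, y))` for extended-real endpoints `x, y`. -/
def muIooE (μ : Measure ℝ) (x y : EReal) : ENNReal :=
  μ {z : ℝ | x < (z : EReal) ∧ (z : EReal) < y}

open Classical in
/-- The Legendre transform extended to `[-∞,+∞]` by continuity, with the paper's
convention `L̄*(−∞) = −L̄(0⁺)`. -/
def LegendreExt (L : ℝ → EReal) (x : EReal) : EReal :=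
  if x = ⊥ then -(rightLimE L 0) else if x = ⊤ then ⊤ else LegendreEE L x

end

section ExponentialScale

lemma elog_lt_iff {c : ℝ} (hc : 0 < c) (m : ENNReal) (w : ℝ) :
    elog c m < (w : EReal) ↔ m < ENNReal.ofReal (Real.exp (w / c)) := by
  rw [← ENNReal.log_lt_log_iff, ENNReal.log_ofReal_of_pos (Real.exp_pos _), Real.log_exp,
    EReal.coe_div, EReal.lt_div_iff (by exact_mod_cast hc) (EReal.coe_ne_top _), elog, mul_comm]

lemma lt_elog_iff {c : ℝ} (hc : 0 < c) (m : ENNReal) (w : ℝ) :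
    (w : EReal) < elog c m ↔ ENNReal.ofReal (Real.exp (w / c)) < m := by
  rw [← ENNReal.log_lt_log_iff, ENNReal.log_ofReal_of_pos (Real.exp_pos _), Real.log_exp,
    EReal.coe_div, EReal.div_lt_iff (by exact_mod_cast hc) (EReal.coe_ne_top _), elog, mul_comm]

lemma elog_mono {c : ℝ} (hc : 0 < c) {m m' : ENNReal} (h : m ≤ m') : elog c m ≤ elog c m' := by
  refine le_of_forall_lt fun w hw => ?_
  obtain ⟨v, hwv, hv⟩ := EReal.lt_iff_exists_real_btwn.1 hw
  exact hwv.trans ((lt_elog_iff hc _ _).2 (((lt_elog_iff hc _ _).1 hv).trans_le h))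

lemma elog_one (c : ℝ) : elog c 1 = 0 := by simp [elog]

variable {ι : Type*} {lf : Filter ι} {μ : ι → Measure ℝ} {c : ι → ℝ}

lemma eventually_lintegral_lt (hc : ∀ i, 0 < c i) {t w : ℝ}
    (h : genLogMGF lf μ c t < (w : EReal)) :
    ∀ᶠ i in lf, ∫⁻ x : ℝ, ENNReal.ofReal (Real.exp (t * x / c i)) ∂ (μ i) <
      ENNReal.ofReal (Real.exp (w / c i)) := by
  filter_upwards [eventually_lt_of_limsup_lt h] with i hi using (elog_lt_iff (hc i) _ _).1 hi

lemma ofReal_exp_le_convex_comb {c s t u p q : ℝ} (hc : 0 < c) (hst : s < t) (htu : t < u)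
    (x : ℝ) :
    ENNReal.ofReal (Real.exp (t * x / c)) ≤
      ENNReal.ofReal (Real.exp (((u - t) * p + (t - s) * q) / (u - s) / c)) *
      (ENNReal.ofReal ((u - t) / (u - s)) * (ENNReal.ofReal (Real.exp (-(p / c))) *
          ENNReal.ofReal (Real.exp (s * x / c))) +
        ENNReal.ofReal ((t - s) / (u - s)) * (ENNReal.ofReal (Real.exp (-(q / c))) *
          ENNReal.ofReal (Real.exp (u * x / c)))) := by
  have hus : 0 < u - s := by linarith
  have h1 : 0 ≤ (u - t) / (u - s) := div_nonneg (by linarith) hus.le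
  have h2 : 0 ≤ (t - s) / (u - s) := div_nonneg (by linarith) hus.le
  have hconv := convexOn_exp.2 (Set.mem_univ (s * x / c - p / c))
    (Set.mem_univ (u * x / c - q / c)) h1 h2 (by field_simp; ring)
  simp only [smul_eq_mul] at hconv
  rw [← ENNReal.ofReal_mul (Real.exp_pos _).le, ← ENNReal.ofReal_mul (Real.exp_pos _).le,
    ← ENNReal.ofReal_mul h1, ← ENNReal.ofReal_mul h2, ← ENNReal.ofReal_add (by positivity)
    (by positivity), ← ENNReal.ofReal_mul (Real.exp_pos _).le]
  apply ENNReal.ofReal_le_ofReal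
  rw [← Real.exp_add, ← Real.exp_add]
  have e1 : t * x / c = ((u - t) * p + (t - s) * q) / (u - s) / c +
      ((u - t) / (u - s) * (s * x / c - p / c) + (t - s) / (u - s) * (u * x / c - q / c)) := by
    field_simp
    ring
  rw [e1, Real.exp_add, show -(p / c) + s * x / c = s * x / c - p / c by ring,
    show -(q / c) + u * x / c = u * x / c - q / c by ring]
  gcongr

/-- Convexity of an extended-real-valued function, tested against real upper bounds. -/
def EConvex (L : ℝ → EReal) : Prop :=
  ∀ s t u p q : ℝ, s < t → t < u → L s < (p : EReal) → L u < (q : EReal) →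
    L t ≤ ((((u - t) * p + (t - s) * q) / (u - s) : ℝ) : EReal)

lemma eConvex_genLogMGF (hc : ∀ i, 0 < c i) : EConvex (genLogMGF lf μ c) := by
  intro s t u p q hst htu hs hu
  refine limsup_le_of_le (by isBoundedDefault) ?_
  filter_upwards [eventually_lintegral_lt hc hs, eventually_lintegral_lt hc hu] with i his hiu
  refine not_lt.1 fun hlt => ?_
  refine ((lt_elog_iff (hc i) _ _).1 hlt).not_ge ?_
  have hus : 0 < u - s := by linarith
  have key : ∀ r : ℝ, ENNReal.ofReal (Real.exp (-(r / c i))) *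
      ENNReal.ofReal (Real.exp (r / c i)) = 1 := fun r => by
    rw [← ENNReal.ofReal_mul (Real.exp_pos _).le, ← Real.exp_add]; simp
  have hm : ∀ r : ℝ, Measurable fun x : ℝ => ENNReal.ofReal (Real.exp (r * x / c i)) :=
    fun r => by fun_prop
  calc ∫⁻ x : ℝ, ENNReal.ofReal (Real.exp (t * x / c i)) ∂ (μ i)
      ≤ ∫⁻ x : ℝ, _ ∂ (μ i) :=
        lintegral_mono fun x => ofReal_exp_le_convex_comb (p := p) (q := q) (hc i) hst htu x
    _ ≤ ENNReal.ofReal (Real.exp (((u - t) * p + (t - s) * q) / (u - s) / c i)) *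
        (ENNReal.ofReal ((u - t) / (u - s)) * (ENNReal.ofReal (Real.exp (-(p / c i))) *
          ENNReal.ofReal (Real.exp (p / c i))) +
        ENNReal.ofReal ((t - s) / (u - s)) * (ENNReal.ofReal (Real.exp (-(q / c i))) *
          ENNReal.ofReal (Real.exp (q / c i)))) := by
        rw [lintegral_const_mul _ (by fun_prop), lintegral_add_left (by fun_prop),
          lintegral_const_mul _ (by fun_prop), lintegral_const_mul _ (by fun_prop),
          lintegral_const_mul _ (by fun_prop), lintegral_const_mul _ (by fun_prop)]
        gcongr
    _ = _ := by
        rw [key, key, mul_one, mul_one, ← ENNReal.ofReal_add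
          (div_nonneg (by linarith) hus.le) (div_nonneg (by linarith) hus.le),
          show (u - t) / (u - s) + (t - s) / (u - s) = 1 by field_simp; ring]
        simp

lemma genLogMGF_zero [lf.NeBot] [∀ i, IsProbabilityMeasure (μ i)] :
    genLogMGF lf μ c 0 = 0 := by
  simp [genLogMGF, elog_one]

/-- Chernoff bound for upper tails. -/
lemma eventually_elog_Ici_lt (hc : ∀ i, 0 < c i) {t f a w : ℝ} (ht : 0 ≤ t)
    (hf : genLogMGF lf μ c t < (f : EReal)) (hw : f - t * a ≤ w) :
    ∀ᶠ i in lf, elog (c i) (μ i (Set.Ici a)) < (w : EReal) := by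
  filter_upwards [eventually_lintegral_lt hc hf] with i hi
  rw [elog_lt_iff (hc i)]
  have hci := hc i
  have h1 : ENNReal.ofReal (Real.exp (t * a / c i)) * μ i (Set.Ici a) ≤
      ∫⁻ x : ℝ, ENNReal.ofReal (Real.exp (t * x / c i)) ∂ (μ i) := by
    rw [← setLIntegral_const]
    refine (setLIntegral_mono (by fun_prop) fun x hx => ?_).trans (setLIntegral_le_lintegral _ _)
    have : a ≤ x := hx
    gcongr
  have h2 : ENNReal.ofReal (Real.exp (t * a / c i)) * μ i (Set.Ici a) <
      ENNReal.ofReal (Real.exp (t * a / c i)) * ENNReal.ofReal (Real.exp (w / c i)) := by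
    refine (h1.trans_lt hi).trans_le ?_
    rw [← ENNReal.ofReal_mul (Real.exp_pos _).le, ← Real.exp_add, ← add_div]
    gcongr
    linarith
  exact lt_of_mul_lt_mul_left' h2

/-- Exponential tilting: the tilted measure at `t` charges `(a, b)` as soon as `a` lies below a
left difference quotient and `b` above a right one. -/
lemma eventually_lt_elog_Ioo (hc : ∀ i, 0 < c i) (hc0 : Tendsto c lf (𝓝 0))
    {t f a b : ℝ} (ht : 0 ≤ t)
    (hf : Tendsto (fun i => elog (c i)
      (∫⁻ x : ℝ, ENNReal.ofReal (Real.exp (t * x / c i)) ∂ (μ i))) lf (𝓝 (f : EReal)))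
    {s p : ℝ} (hs : t < s) (hp : genLogMGF lf μ c s < (p : EReal)) (hpb : p - f < (s - t) * b)
    {s' p' : ℝ} (hs' : s' < t) (hp' : genLogMGF lf μ c s' < (p' : EReal))
    (hpa : (t - s') * a < f - p') {w : ℝ} (hw : w < f - t * b) :
    ∀ᶠ i in lf, (w : EReal) < elog (c i) (μ i (Set.Ioo a b)) := by
  obtain ⟨δ, hδ, hδ1, hδ2, hδ3⟩ : ∃ δ : ℝ, 0 < δ ∧ p - (s - t) * b ≤ f - 2 * δ ∧
      p' + (t - s') * a ≤ f - 2 * δ ∧ w + t * b ≤ f - 2 * δ := by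
    refine ⟨min ((f - p + (s - t) * b) / 2) (min ((f - p' - (t - s') * a) / 2)
      ((f - w - t * b) / 2)), ?_, ?_, ?_, ?_⟩
    · refine lt_min ?_ (lt_min ?_ ?_) <;> linarith
    · linarith [min_le_left ((f - p + (s - t) * b) / 2) (min ((f - p' - (t - s') * a) / 2)
        ((f - w - t * b) / 2))]
    · linarith [(min_le_right ((f - p + (s - t) * b) / 2) (min ((f - p' - (t - s') * a) / 2)
        ((f - w - t * b) / 2))).trans (min_le_left _ _)]
    · linarith [(min_le_right ((f - p + (s - t) * b) / 2) (min ((f - p' - (t - s') * a) / 2)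
        ((f - w - t * b) / 2))).trans (min_le_right _ _)]
  have hlow : ∀ᶠ i in lf, ((f - δ : ℝ) : EReal) < elog (c i)
      (∫⁻ x : ℝ, ENNReal.ofReal (Real.exp (t * x / c i)) ∂ (μ i)) :=
    hf.eventually_const_lt (by exact_mod_cast (by linarith : f - δ < f))
  have hsmall : ∀ᶠ i in lf, c i < δ / 2 := hc0.eventually_lt_const (by linarith)
  filter_upwards [hlow, hsmall, eventually_lintegral_lt hc hp, eventually_lintegral_lt hc hp']
    with i hi hci hip hip'
  have hc' := hc i
  rw [lt_elog_iff hc'] at hi ⊢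
  by_contra! hcon
  refine hi.not_ge ?_
  set E : ENNReal := ENNReal.ofReal (Real.exp ((f - 2 * δ) / c i)) with hE
  have hcover : (Set.univ : Set ℝ) ⊆ Set.Ioo a b ∪ (Set.Ici b ∪ Set.Iic a) := by
    intro x _
    by_cases h1 : b ≤ x
    · exact Or.inr (Or.inl h1)
    · by_cases h2 : x ≤ a
      · exact Or.inr (Or.inr h2)
      · exact Or.inl ⟨not_le.1 h2, not_le.1 h1⟩
  have hmid : ∫⁻ x in Set.Ioo a b, ENNReal.ofReal (Real.exp (t * x / c i)) ∂ (μ i) ≤ E := by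
    calc _ ≤ ∫⁻ x in Set.Ioo a b, ENNReal.ofReal (Real.exp (t * b / c i)) ∂ (μ i) := by
          refine setLIntegral_mono (by fun_prop) fun x hx => ?_
          have : x ≤ b := hx.2.le
          gcongr
      _ = ENNReal.ofReal (Real.exp (t * b / c i)) * μ i (Set.Ioo a b) := setLIntegral_const _ _
      _ ≤ ENNReal.ofReal (Real.exp (t * b / c i)) * ENNReal.ofReal (Real.exp (w / c i)) := by
          gcongr
      _ ≤ E := by
          rw [← ENNReal.ofReal_mul (Real.exp_pos _).le, ← Real.exp_add, ← add_div, hE]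
          gcongr
          linarith
  have htail : ∀ (S : Set ℝ) (r q d : ℝ), MeasurableSet S →
      (∀ x ∈ S, t * x ≤ d + r * x) → d + q ≤ f - 2 * δ →
      ∫⁻ x : ℝ, ENNReal.ofReal (Real.exp (r * x / c i)) ∂ (μ i) <
        ENNReal.ofReal (Real.exp (q / c i)) →
      ∫⁻ x in S, ENNReal.ofReal (Real.exp (t * x / c i)) ∂ (μ i) ≤ E := by
    intro S r q d hS hd hdq hq
    calc _ ≤ ∫⁻ x in S, ENNReal.ofReal (Real.exp (d / c i)) *
            ENNReal.ofReal (Real.exp (r * x / c i)) ∂ (μ i) := by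
          refine setLIntegral_mono (by fun_prop) fun x hx => ?_
          rw [← ENNReal.ofReal_mul (Real.exp_pos _).le, ← Real.exp_add, ← add_div]
          have := hd x hx
          gcongr
      _ ≤ ∫⁻ x, ENNReal.ofReal (Real.exp (d / c i)) *
            ENNReal.ofReal (Real.exp (r * x / c i)) ∂ (μ i) := setLIntegral_le_lintegral _ _
      _ = ENNReal.ofReal (Real.exp (d / c i)) *
            ∫⁻ x, ENNReal.ofReal (Real.exp (r * x / c i)) ∂ (μ i) :=
          lintegral_const_mul _ (by fun_prop)
      _ ≤ ENNReal.ofReal (Real.exp (d / c i)) * ENNReal.ofReal (Real.exp (q / c i)) := by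
          gcongr
      _ ≤ E := by
          rw [← ENNReal.ofReal_mul (Real.exp_pos _).le, ← Real.exp_add, ← add_div, hE]
          gcongr
  have hup := htail (Set.Ici b) s p (-((s - t) * b)) measurableSet_Ici
    (fun x hx => by
      have : b ≤ x := hx
      nlinarith) (by linarith) hip
  have hdown := htail (Set.Iic a) s' p' ((t - s') * a) measurableSet_Iic
    (fun x hx => by
      have : x ≤ a := hx
      nlinarith) (by linarith) hip'
  have h3 : (3 : ℝ) ≤ Real.exp (δ / c i) := by
    have : 2 ≤ δ / c i := by rw [le_div_iff₀ hc']; linarith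
    linarith [Real.add_one_le_exp (δ / c i)]
  calc ∫⁻ x : ℝ, ENNReal.ofReal (Real.exp (t * x / c i)) ∂ (μ i)
      = ∫⁻ x in Set.univ, ENNReal.ofReal (Real.exp (t * x / c i)) ∂ (μ i) := by simp
    _ ≤ ∫⁻ x in Set.Ioo a b ∪ (Set.Ici b ∪ Set.Iic a),
          ENNReal.ofReal (Real.exp (t * x / c i)) ∂ (μ i) := lintegral_mono_set hcover
    _ ≤ E + (E + E) := by
        refine (lintegral_union_le _ _ _).trans (add_le_add hmid ?_)
        exact (lintegral_union_le _ _ _).trans (add_le_add hup hdown)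
    _ ≤ ENNReal.ofReal (Real.exp ((f - δ) / c i)) := by
        rw [hE, ← ENNReal.ofReal_add (by positivity) (by positivity),
          ← ENNReal.ofReal_add (by positivity) (by positivity)]
        apply ENNReal.ofReal_le_ofReal
        rw [show (f - δ) / c i = δ / c i + (f - 2 * δ) / c i by ring, Real.exp_add]
        nlinarith [Real.exp_pos ((f - 2 * δ) / c i)]

end ExponentialScale

section RightDerivative

variable {L : ℝ → EReal}

lemma EReal.exists_coe_of_ne {x : EReal} (hb : x ≠ ⊥) (ht : x ≠ ⊤) : ∃ r : ℝ, x = (r : EReal) :=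
  ⟨x.toReal, (EReal.coe_toReal ht hb).symm⟩

lemma EConvex.real_le (hK : EConvex L) {s t u f g h : ℝ} (hst : s < t) (htu : t < u)
    (hs : L s = (f : EReal)) (ht : L t = (g : EReal)) (hu : L u = (h : EReal)) :
    (u - s) * g ≤ (u - t) * f + (t - s) * h := by
  have hus : 0 < u - s := by linarith
  have key : g ≤ ((u - t) * f + (t - s) * h) / (u - s) := by
    refine le_of_forall_pos_le_add fun ε hε => ?_
    have := hK s t u (f + ε) (h + ε) hst htu (by rw [hs]; exact_mod_cast (by linarith))
      (by rw [hu]; exact_mod_cast (by linarith))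
    rw [ht, EReal.coe_le_coe_iff] at this
    refine this.trans (le_of_eq ?_)
    field_simp
    ring
  rw [le_div_iff₀ hus] at key
  linarith

lemma EConvex.ne_top (hK : EConvex L) {s t u : ℝ} (hst : s < t) (htu : t < u)
    (hs : L s ≠ ⊤) (hu : L u ≠ ⊤) : L t ≠ ⊤ := by
  obtain ⟨p, hp, -⟩ := EReal.lt_iff_exists_real_btwn.1 hs.lt_top
  obtain ⟨q, hq, -⟩ := EReal.lt_iff_exists_real_btwn.1 hu.lt_top
  exact ((hK s t u p q hst htu hp hq).trans_lt (EReal.coe_lt_top _)).ne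

lemma EConvex.eq_bot (hK : EConvex L) {s t u : ℝ} (hst : s < t) (htu : t < u)
    (hs : L s ≠ ⊤) (hu : L u = ⊥) : L t = ⊥ := by
  obtain ⟨p, hp, -⟩ := EReal.lt_iff_exists_real_btwn.1 hs.lt_top
  rw [EReal.eq_bot_iff_forall_lt]
  intro y
  have hts : 0 < t - s := by linarith
  have hus : 0 < u - s := by linarith
  refine (hK s t u p (((y - 1) * (u - s) - (u - t) * p) / (t - s)) hst htu hp
    (hu ▸ EReal.bot_lt_coe _)).trans_lt ?_
  rw [EReal.coe_lt_coe_iff]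
  have : ((u - t) * p + (t - s) * (((y - 1) * (u - s) - (u - t) * p) / (t - s))) / (u - s)
      = y - 1 := by
    field_simp
    ring
  linarith

lemma rightDerivE_le {s t f g : ℝ} (hst : s < t) (hs : L s = (f : EReal))
    (ht : L t = (g : EReal)) : rightDerivE L s ≤ (((g - f) / (t - s) : ℝ) : EReal) := by
  rw [rightDerivE, if_neg]
  · split_ifs
    · exact bot_le
    · refine (iInf₂_le t hst).trans (le_of_eq ?_)
      rw [hs, ht]
      norm_cast
  · intro h
    simpa [ht] using h t hst

lemma le_rightDerivE {s p f : ℝ} (hs : L s = (f : EReal)) (hbot : ∀ t, s < t → L t ≠ ⊥)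
    (h : ∀ t g : ℝ, s < t → L t = (g : EReal) → p * (t - s) ≤ g - f) :
    (p : EReal) ≤ rightDerivE L s := by
  rw [rightDerivE]
  split_ifs with h1 h2
  · exact le_top
  · obtain ⟨t, ht, htb⟩ := h2
    exact absurd htb (hbot t ht)
  · refine le_iInf₂ fun t ht => ?_
    have ht : s < t := ht
    have hts : 0 < t - s := by linarith
    by_cases htop : L t = ⊤
    · rw [htop, hs, EReal.top_sub_coe, EReal.top_mul_coe_of_pos (inv_pos.2 hts)]
      exact le_top
    · obtain ⟨g, hg⟩ := EReal.exists_coe_of_ne (hbot t ht) htop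
      rw [hg, hs]
      have := h t g ht hg
      rw [← le_div_iff₀ hts, div_eq_mul_inv] at this
      exact_mod_cast this

lemma exists_lt_of_rightDerivE_lt {s f b : ℝ} (hs : L s = (f : EReal))
    (h : rightDerivE L s < (b : EReal)) :
    ∃ t p : ℝ, s < t ∧ L t < (p : EReal) ∧ p - f < (t - s) * b := by
  have aux : ∀ t, s < t → L t < ((f + (t - s) * b : ℝ) : EReal) →
      ∃ t p : ℝ, s < t ∧ L t < (p : EReal) ∧ p - f < (t - s) * b := by
    intro t hst ht
    obtain ⟨p, hp, hp'⟩ := EReal.lt_iff_exists_real_btwn.1 ht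
    rw [EReal.coe_lt_coe_iff] at hp'
    exact ⟨t, p, hst, hp, by linarith⟩
  rw [rightDerivE] at h
  split_ifs at h with h1 h2
  · exact absurd h (by simp)
  · obtain ⟨t, hst, ht⟩ := h2
    exact aux t hst (ht ▸ EReal.bot_lt_coe _)
  · obtain ⟨t, ht⟩ := iInf_lt_iff.1 h
    obtain ⟨hst, ht⟩ := iInf_lt_iff.1 ht
    have hst : s < t := hst
    have hts : 0 < t - s := by linarith
    refine aux t hst ?_
    induction hLt : L t with
    | bot => exact EReal.bot_lt_coe _
    | top =>
      rw [hLt, hs, EReal.top_sub_coe, EReal.top_mul_coe_of_pos (inv_pos.2 hts)] at ht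
      exact absurd ht (by simp)
    | coe g =>
      rw [hLt, hs] at ht
      have ht : (g - f) * (t - s)⁻¹ < b := by exact_mod_cast ht
      rw [← div_eq_mul_inv, div_lt_iff₀ hts] at ht
      rw [EReal.coe_lt_coe_iff]
      linarith

lemma rightDerivE_eq_top {t : ℝ} (h : ∀ s, t < s → L s = ⊤) : rightDerivE L t = ⊤ := if_pos h

lemma rightDerivE_eq_bot {s t : ℝ} (hst : s < t) (h : L t = ⊥) : rightDerivE L s = ⊥ := by
  rw [rightDerivE, if_neg, if_pos ⟨t, hst, h⟩]
  intro h'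
  simpa [h] using h' t hst

lemma EConvex.slope_le_rightDerivE (hK : EConvex L) {s t f g : ℝ} (hst : s < t)
    (hbot : ∀ u, t < u → L u ≠ ⊥) (hs : L s = (f : EReal)) (ht : L t = (g : EReal)) :
    (((g - f) / (t - s) : ℝ) : EReal) ≤ rightDerivE L t := by
  refine le_rightDerivE ht hbot fun u h htu hu => ?_
  have h1 := hK.real_le hst htu hs ht hu
  have hts : 0 < t - s := by linarith
  rw [div_mul_eq_mul_div, div_le_iff₀ hts]
  nlinarith

variable {a : ℝ}

lemma EConvex.rightDerivE_mono (hK : EConvex L) (ha : 0 ≤ a) (h0 : L 0 = 0)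
    (hbot : ∀ t, a < t → L t ≠ ⊥) {s t : ℝ} (has : a < s) (hst : s < t) :
    rightDerivE L s ≤ rightDerivE L t := by
  have h0' : L 0 ≠ ⊤ := by simp [h0]
  by_cases htop : L t = ⊤
  · rw [rightDerivE_eq_top (t := t)]
    · exact le_top
    · intro u htu
      by_contra hu
      exact hK.ne_top (by linarith) htu h0' hu htop
  · obtain ⟨g, hg⟩ := EReal.exists_coe_of_ne (hbot t (has.trans hst)) htop
    obtain ⟨f, hf⟩ := EReal.exists_coe_of_ne (hbot s has)
      (hK.ne_top (by linarith) hst h0' htop)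
    exact (rightDerivE_le hst hf hg).trans
      (hK.slope_le_rightDerivE hst (fun u hu => hbot u (by linarith)) hf hg)

lemma EConvex.rightLimE_rightDerivE_le (hK : EConvex L) (ha : 0 ≤ a) (h0 : L 0 = 0)
    (hbot : ∀ t, a < t → L t ≠ ⊥) {t : ℝ} (hat : a < t) :
    rightLimE (rightDerivE L) a ≤ rightDerivE L t := by
  refine limsup_le_of_le (by isBoundedDefault) ?_
  filter_upwards [Ioo_mem_nhdsGT hat] with s hs
  exact hK.rightDerivE_mono ha h0 hbot hs.1 hs.2

/-- On an interval where `L` is affine, the right derivative is constant. -/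
lemma EConvex.rightDerivE_of_affine (hK : EConvex L) {b p q : ℝ}
    (hbot : ∀ t, a < t → L t ≠ ⊥)
    (haff : ∀ s ∈ Set.Ioc a b, L s = ((p * s + q : ℝ) : EReal)) {t : ℝ} (ht : t ∈ Set.Ioo a b) :
    rightDerivE L t = (p : EReal) := by
  have hLt := haff t ⟨ht.1, ht.2.le⟩
  have hLb := haff b ⟨ht.1.trans ht.2, le_rfl⟩
  obtain ⟨s, has, hst⟩ := exists_between ht.1
  have hLs := haff s ⟨has, hst.le.trans ht.2.le⟩
  apply le_antisymm
  · refine (rightDerivE_le ht.2 hLt hLb).trans (le_of_eq ?_)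
    have : b - t ≠ 0 := by linarith [ht.2]
    congr 1
    field_simp
    ring
  · refine le_trans (le_of_eq ?_)
      (hK.slope_le_rightDerivE hst (fun u hu => hbot u (by linarith [ht.1])) hLs hLt)
    have : t - s ≠ 0 := by linarith
    congr 1
    field_simp
    ring

lemma EConvex.rightLimE_rightDerivE_of_affine (hK : EConvex L) {b p q : ℝ} (hab : a < b)
    (hbot : ∀ t, a < t → L t ≠ ⊥)
    (haff : ∀ s ∈ Set.Ioc a b, L s = ((p * s + q : ℝ) : EReal)) :
    rightLimE (rightDerivE L) a = (p : EReal) := by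
  refine (Tendsto.congr' ?_ tendsto_const_nhds).limsup_eq
  filter_upwards [Ioo_mem_nhdsGT hab] with t ht
  exact (hK.rightDerivE_of_affine hbot haff ht).symm

/-- A point of `(a, ∞)` whose right derivative exceeds the limiting one bounds the
intervals of affineness. -/
lemma EConvex.le_of_affineOnIoc (hK : EConvex L) (hbot : ∀ t, a < t → L t ≠ ⊥)
    {b u : ℝ} (hau : a < u) (hu : rightLimE (rightDerivE L) a < rightDerivE L u)
    (hb : AffineOnIoc L a b) : b ≤ u := by
  by_contra! hub
  obtain ⟨p, q, haff⟩ := hb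
  rw [hK.rightLimE_rightDerivE_of_affine (hau.trans hub) hbot haff,
    hK.rightDerivE_of_affine hbot haff ⟨hau, hub⟩] at hu
  exact hu.false

end RightDerivative

section LimitPoint

variable {L : ℝ → EReal} {a : ℝ}

lemma EConvex.mem_upperBounds_affineOnIoc (hK : EConvex L) (hbot : ∀ t, a < t → L t ≠ ⊥)
    {u : ℝ} (hau : a < u) (hu : rightLimE (rightDerivE L) a < rightDerivE L u) :
    u ∈ upperBounds (insert a {t : ℝ | a < t ∧ AffineOnIoc L a t}) := by
  rintro b (rfl | ⟨-, hb⟩)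
  · exact hau.le
  · exact hK.le_of_affineOnIoc hbot hau hu hb

lemma EConvex.tildeOf_le (hK : EConvex L) (hbot : ∀ t, a < t → L t ≠ ⊥)
    {u : ℝ} (hau : a < u) (hu : rightLimE (rightDerivE L) a < rightDerivE L u) :
    tildeOf L a ≤ u :=
  csSup_le (Set.insert_nonempty _ _) (hK.mem_upperBounds_affineOnIoc hbot hau hu)

/-- The limiting right derivative at `a⁺` is approached, from strictly above, by right
derivatives at points to the right of `a`. -/
def RightDerivAccumulates (L : ℝ → EReal) (a : ℝ) : Prop :=
  rightLimE (rightDerivE L) a < ⊤ ∧ ∀ b : EReal, rightLimE (rightDerivE L) a < b →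
    ∃ u, a < u ∧ rightLimE (rightDerivE L) a < rightDerivE L u ∧ rightDerivE L u < b

lemma EConvex.le_tildeOf (hK : EConvex L) (hbot : ∀ t, a < t → L t ≠ ⊥)
    (hacc : RightDerivAccumulates L a) : a ≤ tildeOf L a := by
  obtain ⟨u, hau, hu, -⟩ := hacc.2 ⊤ hacc.1
  exact le_csSup ⟨u, hK.mem_upperBounds_affineOnIoc hbot hau hu⟩ (Set.mem_insert _ _)

lemma EConvex.eventually_rightDerivE_lt (hK : EConvex L) (ha : 0 ≤ a) (h0 : L 0 = 0)
    (hbot : ∀ t, a < t → L t ≠ ⊥) (hacc : RightDerivAccumulates L a) {b : EReal}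
    (hb : rightLimE (rightDerivE L) a < b) :
    ∀ᶠ t in 𝓝[>] (tildeOf L a), rightDerivE L t < b := by
  obtain ⟨u, hau, hu, hub⟩ := hacc.2 b hb
  obtain ⟨v, hav, hv, hvu⟩ := hacc.2 _ hu
  have hvu' : v < u := by
    by_contra! h
    rcases h.eq_or_lt with rfl | h
    · exact hvu.false
    · exact (hK.rightDerivE_mono ha h0 hbot hau h).not_gt hvu
  have hT := (hK.tildeOf_le hbot hav hv).trans_lt hvu'
  filter_upwards [Ioo_mem_nhdsGT hT] with t ht
  exact (hK.rightDerivE_mono ha h0 hbot ((hK.le_tildeOf hbot hacc).trans_lt ht.1) ht.2).trans_lt hub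

lemma EConvex.ne_top_of_rightDerivE_lt_top (hK : EConvex L) (h0 : L 0 = 0) {t : ℝ} (ht : 0 < t)
    (h : rightDerivE L t < ⊤) : L t ≠ ⊤ := by
  by_contra htop
  refine h.ne (rightDerivE_eq_top fun s hs => ?_)
  by_contra hs'
  exact hK.ne_top ht hs (by simp [h0]) hs' htop

lemma EConvex.rightLimE_le_slope (hK : EConvex L) (ha : 0 ≤ a) (h0 : L 0 = 0)
    (hbot : ∀ t, a < t → L t ≠ ⊥) {s t f g : ℝ} (has : a < s) (hst : s < t)
    (hs : L s = (f : EReal)) (ht : L t = (g : EReal)) :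
    rightLimE (rightDerivE L) a ≤ (((g - f) / (t - s) : ℝ) : EReal) :=
  (hK.rightLimE_rightDerivE_le ha h0 hbot has).trans (rightDerivE_le hst hs ht)

/-- To the right of `tildeOf L a`, some left difference quotient exceeds the limiting slope. -/
lemma EConvex.exists_slope_gt (hK : EConvex L) (ha : 0 ≤ a) (h0 : L 0 = 0)
    (hbot : ∀ t, a < t → L t ≠ ⊥) (hacc : RightDerivAccumulates L a) {t g : ℝ}
    (hTt : tildeOf L a < t) (ht : L t = (g : EReal)) :
    ∃ s f m : ℝ, s < t ∧ L s = (f : EReal) ∧ rightLimE (rightDerivE L) a < (m : EReal) ∧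
      (t - s) * m < g - f := by
  have hat : a < t := (hK.le_tildeOf hbot hacc).trans_lt hTt
  have hreal : ∀ s, a < s → s < t → ∃ f : ℝ, L s = (f : EReal) := fun s has hst =>
    EReal.exists_coe_of_ne (hbot s has)
      (hK.ne_top (ha.trans_lt has) hst (by simp [h0]) (by simp [ht]))
  by_contra! hcon
  have hslope : ∀ s f : ℝ, a < s → s < t → L s = (f : EReal) →
      rightLimE (rightDerivE L) a = (((g - f) / (t - s) : ℝ) : EReal) := by
    intro s f has hst hs
    refine le_antisymm (hK.rightLimE_le_slope ha h0 hbot has hst hs ht) ?_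
    by_contra! hlt
    obtain ⟨m, hm, hm'⟩ := EReal.lt_iff_exists_real_btwn.1 hlt
    have := hcon s f m hst hs hm
    rw [EReal.coe_lt_coe_iff, lt_div_iff₀ (by linarith)] at hm'
    linarith
  obtain ⟨s₀, has₀, hs₀t⟩ := exists_between hat
  obtain ⟨f₀, hf₀⟩ := hreal s₀ has₀ hs₀t
  have hr := hslope s₀ f₀ has₀ hs₀t hf₀
  set r := (g - f₀) / (t - s₀)
  refine hTt.not_ge ?_
  obtain ⟨u, hau, hu, -⟩ := hacc.2 ⊤ hacc.1
  refine le_csSup ⟨u, hK.mem_upperBounds_affineOnIoc hbot hau hu⟩ (Or.inr ⟨hat, r, g - r * t, ?_⟩)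
  rintro s ⟨has, hst⟩
  rcases hst.eq_or_lt with rfl | hst
  · rw [ht]
    congr 1
    ring
  · obtain ⟨f, hf⟩ := hreal s has hst
    have h := hslope s f has hst hf
    rw [hr, EReal.coe_eq_coe_iff, eq_div_iff (by linarith)] at h
    rw [hf, EReal.coe_eq_coe_iff]
    linarith

/-- The right limit lies below the extrapolation along the limiting slope. -/
lemma EConvex.rightLimE_le (hK : EConvex L) (ha : 0 ≤ a) (h0 : L 0 = 0)
    (hbot : ∀ t, a < t → L t ≠ ⊥) {r t g : ℝ}
    (hr : rightLimE (rightDerivE L) a = (r : EReal)) (hat : a < t) (ht : L t = (g : EReal)) :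
    rightLimE L a ≤ ((g - r * (t - a) : ℝ) : EReal) := by
  have hlim : Tendsto (fun s : ℝ => ((g - r * (t - s) : ℝ) : EReal)) (𝓝[>] a)
      (𝓝 ((g - r * (t - a) : ℝ) : EReal)) := by
    refine tendsto_nhdsWithin_of_tendsto_nhds ?_
    exact (continuous_coe_real_ereal.comp (by fun_prop :
      Continuous fun s : ℝ => g - r * (t - s))).tendsto a
  rw [← hlim.limsup_eq]
  refine limsup_le_limsup ?_
  filter_upwards [Ioo_mem_nhdsGT hat] with s hs
  obtain ⟨f, hf⟩ := EReal.exists_coe_of_ne (hbot s hs.1)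
    (hK.ne_top (ha.trans_lt hs.1) hs.2 (by simp [h0]) (by simp [ht]))
  have h := hK.rightLimE_le_slope ha h0 hbot hs.1 hs.2 hf ht
  rw [hr, EReal.coe_le_coe_iff, le_div_iff₀ (by linarith [hs.2])] at h
  rw [hf, EReal.coe_le_coe_iff]
  linarith

lemma ne_bot_of_rightLimE_ne_bot {t : ℝ} (h : rightLimE (rightDerivE L) a ≠ ⊥) (hat : a < t) :
    L t ≠ ⊥ := by
  intro ht
  refine h (Tendsto.congr' ?_ tendsto_const_nhds).limsup_eq
  filter_upwards [Ioo_mem_nhdsGT hat] with s hs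
  exact (rightDerivE_eq_bot hs.2 ht).symm

lemma EConvex.ne_bot_of_tendsto (hK : EConvex L) (h0 : L 0 = 0)
    (hlim : Tendsto L (𝓝[>] 0) (𝓝 0)) {t : ℝ} (ht : 0 < t) : L t ≠ ⊥ := by
  intro htb
  have h1 : ∀ᶠ s in 𝓝[>] (0 : ℝ), ⊥ < L s := hlim.eventually_const_lt (by simp)
  obtain ⟨s, hs, hs'⟩ := (h1.and (Ioo_mem_nhdsGT ht)).exists
  exact hs.ne' (hK.eq_bot hs'.1 hs'.2 (by simp [h0]) htb)

lemma EConvex.rightDerivAccumulates_of_tendsto (hK : EConvex L) (h0 : L 0 = 0)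
    (hlim : Tendsto L (𝓝[>] 0) (𝓝 0)) (hR : rightLimE (rightDerivE L) 0 = ⊥) :
    RightDerivAccumulates L 0 := by
  refine ⟨by simp [hR], fun b hb => ?_⟩
  have h1 : ∀ᶠ s in 𝓝[>] (0 : ℝ), L s < ⊤ := hlim.eventually_lt_const (by simp)
  have hbot : ∀ t, 0 < t → L t ≠ ⊥ := fun t ht => hK.ne_bot_of_tendsto h0 hlim ht
  obtain ⟨u, ⟨hub, hu⟩, hu0⟩ :=
    (((eventually_lt_of_limsup_lt hb).and h1).and self_mem_nhdsWithin).exists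
  have hu0 : 0 < u := hu0
  obtain ⟨g, hg⟩ := EReal.exists_coe_of_ne (hbot u hu0) hu.ne
  refine ⟨u, hu0, ?_, hub⟩
  rw [hR]
  exact (EReal.bot_lt_coe _).trans_le (hK.slope_le_rightDerivE hu0
    (fun v hv => hbot v (hu0.trans hv)) (h0.trans EReal.coe_zero.symm) hg)

lemma EConvex.tildeOf_zero_of_tendsto (hK : EConvex L) (h0 : L 0 = 0)
    (hlim : Tendsto L (𝓝[>] 0) (𝓝 0)) (hR : rightLimE (rightDerivE L) 0 = ⊥) :
    tildeOf L 0 = 0 := by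
  have hbot : ∀ t, 0 < t → L t ≠ ⊥ := fun t ht => hK.ne_bot_of_tendsto h0 hlim ht
  have hacc := hK.rightDerivAccumulates_of_tendsto h0 hlim hR
  refine le_antisymm (le_of_forall_pos_le_add fun ε hε => ?_) (hK.le_tildeOf hbot hacc)
  have h1 : ∀ᶠ s in 𝓝[>] (0 : ℝ), L s < ⊤ := hlim.eventually_lt_const (by simp)
  obtain ⟨s, hs, hs'⟩ := (h1.and (Ioo_mem_nhdsGT hε)).exists
  obtain ⟨g, hg⟩ := EReal.exists_coe_of_ne (hbot s hs'.1) hs.ne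
  refine (hK.tildeOf_le hbot hs'.1 ?_).trans (by linarith [hs'.2])
  rw [hR]
  exact (EReal.bot_lt_coe _).trans_le (hK.slope_le_rightDerivE hs'.1
    (fun v hv => hbot v (hs'.1.trans hv)) (h0.trans EReal.coe_zero.symm) hg)

/-- Choice of a tilting parameter along a sequence decreasing to `tildeOf L a`, when the limiting
slope is finite. -/
lemma EConvex.exists_tilt_of_coe (hK : EConvex L) (ha : 0 ≤ a) (h0 : L 0 = 0)
    (hbot : ∀ t, a < t → L t ≠ ⊥) (hacc : RightDerivAccumulates L a) {r w : ℝ}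
    (hr : rightLimE (rightDerivE L) a = (r : EReal)) {tseq : ℕ → ℝ}
    (hts : Tendsto tseq atTop (𝓝[>] (tildeOf L a)))
    (hw : (w : EReal) < rightLimE L a - (a : EReal) * rightLimE (rightDerivE L) a)
    {B : EReal} (hB : rightLimE (rightDerivE L) a < B) :
    ∃ i : ℕ, ∃ f b : ℝ, tildeOf L a < tseq i ∧ L (tseq i) = (f : EReal) ∧
      rightDerivE L (tseq i) < (b : EReal) ∧ (b : EReal) < B ∧ w < f - tseq i * b := by
  obtain ⟨v, hwv, hv⟩ := EReal.lt_iff_exists_real_btwn.1 hw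
  rw [EReal.coe_lt_coe_iff] at hwv
  have hT := hK.le_tildeOf hbot hacc
  set T := tildeOf L a
  have hT2 : 0 < T + 1 := by linarith
  have hd : 0 < (v - w) / (T + 1) := div_pos (by linarith) hT2
  obtain ⟨b, hb1, hb2⟩ := EReal.lt_iff_exists_real_btwn.1
    (lt_min hB (show rightLimE (rightDerivE L) a < ((r + (v - w) / (T + 1) : ℝ) : EReal) by
      rw [hr, EReal.coe_lt_coe_iff]; linarith))
  obtain ⟨i, hi, hiT⟩ := (hts.eventually ((hK.eventually_rightDerivE_lt ha h0 hbot hacc hb1).and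
    (Ioo_mem_nhdsGT (lt_add_one T)))).exists
  have hai : a < tseq i := hT.trans_lt hiT.1
  obtain ⟨f, hf⟩ := EReal.exists_coe_of_ne (hbot _ hai)
    (hK.ne_top_of_rightDerivE_lt_top h0 (ha.trans_lt hai) (hi.trans (EReal.coe_lt_top b)))
  refine ⟨i, f, b, hiT.1, hf, hi, hb2.trans_le (min_le_left _ _), ?_⟩
  have hb3 := hb2.trans_le (min_le_right _ _)
  rw [EReal.coe_lt_coe_iff] at hb3
  rw [hr, EReal.coe_lt_coe_iff] at hb1
  have h1 := hv.trans_le (EReal.sub_le_sub (hK.rightLimE_le ha h0 hbot hr hai hf) le_rfl)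
  rw [hr] at h1
  have h2 : v < f - r * (tseq i - a) - a * r := by exact_mod_cast h1
  have h3 : (b - r) * (T + 1) < v - w := by
    rw [← lt_div_iff₀ hT2]
    linarith
  nlinarith [hiT.2]

/-- Choice of a tilting parameter when the limiting slope at `0⁺` is `-∞`. -/
lemma EConvex.exists_tilt_of_tendsto (hK : EConvex L) (h0 : L 0 = 0)
    (hlim : Tendsto L (𝓝[>] 0) (𝓝 0)) (hR : rightLimE (rightDerivE L) 0 = ⊥) {tseq : ℕ → ℝ}
    (hts : Tendsto tseq atTop (𝓝[>] (tildeOf L 0))) {w : ℝ} (hw : w < 0)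
    {B : EReal} (hB : ⊥ < B) :
    ∃ i : ℕ, ∃ f b : ℝ, tildeOf L 0 < tseq i ∧ L (tseq i) = (f : EReal) ∧
      rightDerivE L (tseq i) < (b : EReal) ∧ (b : EReal) < B ∧ w < f - tseq i * b := by
  have hbot : ∀ t, 0 < t → L t ≠ ⊥ := fun t ht => hK.ne_bot_of_tendsto h0 hlim ht
  have hacc := hK.rightDerivAccumulates_of_tendsto h0 hlim hR
  have hder : ∀ b : EReal, ⊥ < b → ∀ᶠ t in 𝓝[>] (0 : ℝ), rightDerivE L t < b := fun b hb => by
    have := hK.eventually_rightDerivE_lt le_rfl h0 hbot hacc (hR ▸ hb)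
    rwa [hK.tildeOf_zero_of_tendsto h0 hlim hR] at this
  rw [hK.tildeOf_zero_of_tendsto h0 hlim hR] at hts ⊢
  obtain ⟨b, hb1, hb2⟩ := EReal.lt_iff_exists_real_btwn.1 hB
  have h1 : ∀ᶠ t in 𝓝[>] (0 : ℝ), ((w / 2 : ℝ) : EReal) < L t :=
    hlim.eventually_const_lt (by exact_mod_cast (by linarith : w / 2 < 0))
  have h2 : ∀ᶠ t in 𝓝[>] (0 : ℝ), L t < ⊤ := hlim.eventually_lt_const (by simp)
  have h3 : ∀ᶠ t in 𝓝[>] (0 : ℝ), t * b < -(w / 2) := by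
    refine eventually_nhdsWithin_of_eventually_nhds ?_
    exact ((continuous_id.mul continuous_const).tendsto (0 : ℝ)).eventually_lt_const
      (by simp; linarith)
  obtain ⟨i, ⟨⟨⟨hi1, hi2⟩, hi3⟩, hi4⟩, hi5⟩ := (hts.eventually
    ((((h1.and h2).and h3).and (hder b hb1)).and self_mem_nhdsWithin)).exists
  obtain ⟨f, hf⟩ := EReal.exists_coe_of_ne (hbot _ hi5) hi2.ne
  refine ⟨i, f, b, hi5, hf, hi4, hb2, ?_⟩
  rw [hf, EReal.coe_lt_coe_iff] at hi1
  linarith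

/-- Near `a⁺`, `L t - r t` gets below any level above `L(a⁺) - a r`. -/
lemma exists_lt_of_rightLimE_lt {r w : ℝ}
    (hw : rightLimE L a - (a : EReal) * (r : EReal) < (w : EReal)) :
    ∃ t f : ℝ, a < t ∧ L t < (f : EReal) ∧ f - t * r < w := by
  have h1 : rightLimE L a < ((w + a * r : ℝ) : EReal) := by
    have h := (EReal.sub_lt_iff (by left; exact EReal.coe_ne_bot (a * r))
      (by left; exact EReal.coe_ne_top (a * r))).1 hw
    exact_mod_cast h
  obtain ⟨f, hf1, hf2⟩ := EReal.lt_iff_exists_real_btwn.1 h1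
  rw [EReal.coe_lt_coe_iff] at hf2
  have h2 : ∀ᶠ t in 𝓝[>] a, f - t * r < w := by
    refine eventually_nhdsWithin_of_eventually_nhds ?_
    exact ((by fun_prop : Continuous fun t : ℝ => f - t * r).tendsto a).eventually_lt_const
      (by linarith)
  obtain ⟨t, ⟨ht1, ht2⟩, ht3⟩ :=
    (((eventually_lt_of_limsup_lt hf1).and h2).and self_mem_nhdsWithin).exists
  exact ⟨t, f, ht3, ht1, ht2⟩

end LimitPoint

section IntervalAsymptotics

variable {ι : Type*} {lf : Filter ι} {μ : ι → Measure ℝ} {c : ι → ℝ} {x y : ι → EReal}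

lemma eventually_lt_elog_muIooE (hc : ∀ i, 0 < c i) {m b w : ℝ}
    (hx : ∀ᶠ i in lf, x i < (m : EReal)) (hy : ∀ᶠ i in lf, (b : EReal) < y i)
    (h : ∀ᶠ i in lf, (w : EReal) < elog (c i) (μ i (Set.Ioo m b))) :
    ∀ᶠ i in lf, (w : EReal) < elog (c i) (muIooE (μ i) (x i) (y i)) := by
  filter_upwards [hx, hy, h] with i hxi hyi hi
  refine hi.trans_le (elog_mono (hc i) (measure_mono fun z hz => ⟨hxi.trans ?_, lt_trans ?_ hyi⟩))
  · exact EReal.coe_lt_coe_iff.2 hz.1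
  · exact EReal.coe_lt_coe_iff.2 hz.2

lemma eventually_elog_muIccE_lt (hc : ∀ i, 0 < c i) {m w : ℝ}
    (hx : ∀ᶠ i in lf, (m : EReal) < x i)
    (h : ∀ᶠ i in lf, elog (c i) (μ i (Set.Ici m)) < (w : EReal)) :
    ∀ᶠ i in lf, elog (c i) (muIccE (μ i) (x i) (y i)) < (w : EReal) := by
  filter_upwards [hx, h] with i hxi hi
  refine (elog_mono (hc i) (measure_mono fun z hz => ?_)).trans_lt hi
  exact EReal.coe_le_coe_iff.1 (hxi.le.trans hz.1)

lemma muIooE_le_muIccE (ν : Measure ℝ) (p q : EReal) : muIooE ν p q ≤ muIccE ν p q :=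
  measure_mono fun _ hz => ⟨hz.1.le, hz.2.le⟩

lemma elog_le_zero {d : ℝ} (hd : 0 < d) (ν : Measure ℝ) [IsProbabilityMeasure ν] (s : Set ℝ) :
    elog d (ν s) ≤ 0 :=
  (elog_mono hd prob_le_one).trans_eq (elog_one d)

end IntervalAsymptotics

theorem statement2
    {ι : Type*} (lf : Filter ι) [lf.NeBot]
    (μ : ι → Measure ℝ) [∀ i, IsProbabilityMeasure (μ i)]
    (c : ι → ℝ) (hc : ∀ i, 0 < c i) (hc0 : Filter.Tendsto c lf (nhds (0 : ℝ)))
    (L : ℝ → EReal) (hL : L = genLogMGF lf μ c)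
    (lam : ℝ) (hlam : 0 ≤ lam)
    (hyp : (rightLimE (rightDerivE L) lam ≠ ⊥ ∧
        ∃ u : ℕ → ℝ, (∀ n, lam < u n) ∧
          (∀ n, rightLimE (rightDerivE L) lam < rightDerivE L (u n)) ∧
          Filter.Tendsto (fun n => rightDerivE L (u n)) Filter.atTop (nhds (rightLimE (rightDerivE L) lam))) ∨
      (lam = 0 ∧ rightLimE (rightDerivE L) 0 = ⊥ ∧
        Filter.Tendsto L (nhdsWithin 0 (Set.Ioi 0)) (nhds (0 : EReal))))
    (tseq : ℕ → ℝ) (htgt : ∀ i, tildeOf L lam < tseq i)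
    (htlim : Filter.Tendsto tseq Filter.atTop (nhds (tildeOf L lam)))
    (hex : ∀ i, ∃ Li : EReal,
      Filter.Tendsto (fun a => elog (c a)
        (∫⁻ x : ℝ, ENNReal.ofReal (Real.exp (tseq i * x / c a)) ∂ (μ a))) lf (nhds Li))
    (x y : ι → EReal)
    (hx : Filter.Tendsto x lf (nhds (rightLimE (rightDerivE L) lam)))
    (hy : rightLimE (rightDerivE L) lam < Filter.liminf y lf) :
    Filter.Tendsto (fun i => elog (c i) (muIccE (μ i) (x i) (y i))) lf
      (nhds (rightLimE L lam - (lam : EReal) * rightLimE (rightDerivE L) lam)) ∧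
    Filter.Tendsto (fun i => elog (c i) (muIooE (μ i) (x i) (y i))) lf
      (nhds (rightLimE L lam - (lam : EReal) * rightLimE (rightDerivE L) lam)) := by
  have hK : EConvex L := hL ▸ eConvex_genLogMGF hc
  have h0 : L 0 = 0 := hL ▸ genLogMGF_zero
  have hts : Tendsto tseq atTop (𝓝[>] (tildeOf L lam)) :=
    tendsto_nhdsWithin_iff.2 ⟨htlim, Eventually.of_forall htgt⟩
  have hybig : ∀ b : ℝ, (b : EReal) < liminf y lf → ∀ᶠ i in lf, (b : EReal) < y i :=
    fun b hb => eventually_lt_of_lt_liminf hb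
  obtain ⟨hbot, hacc, htilt, hupper⟩ : (∀ t, lam < t → L t ≠ ⊥) ∧ RightDerivAccumulates L lam ∧
      (∀ w : ℝ, (w : EReal) < rightLimE L lam - (lam : EReal) * rightLimE (rightDerivE L) lam →
        ∃ i : ℕ, ∃ f b : ℝ, tildeOf L lam < tseq i ∧ L (tseq i) = (f : EReal) ∧
          rightDerivE L (tseq i) < (b : EReal) ∧ (b : EReal) < liminf y lf ∧
          w < f - tseq i * b) ∧
      (∀ w : ℝ, rightLimE L lam - (lam : EReal) * rightLimE (rightDerivE L) lam < (w : EReal) →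
        ∀ᶠ i in lf, elog (c i) (muIccE (μ i) (x i) (y i)) < (w : EReal)) := by
    rcases hyp with ⟨hR, u, hu1, hu2, hu3⟩ | ⟨rfl, hR, hlim⟩
    · have hbot : ∀ t, lam < t → L t ≠ ⊥ := fun t ht => ne_bot_of_rightLimE_ne_bot hR ht
      have hacc : RightDerivAccumulates L lam := by
        refine ⟨(hu2 0).trans_le le_top, fun b hb => ?_⟩
        obtain ⟨n, hn⟩ := (hu3.eventually_lt_const hb).exists
        exact ⟨u n, hu1 n, hu2 n, hn⟩
      obtain ⟨r, hr⟩ := EReal.exists_coe_of_ne hR hacc.1.ne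
      refine ⟨hbot, hacc, fun w hw =>
        hK.exists_tilt_of_coe hlam h0 hbot hacc hr hts hw hy, fun w hw => ?_⟩
      rw [hr] at hw hx
      obtain ⟨t, f, hat, hf, hfw⟩ := exists_lt_of_rightLimE_lt hw
      have ht0 : 0 < t := hlam.trans_lt hat
      have hm : r - (w - (f - t * r)) / t < r := by
        have : 0 < (w - (f - t * r)) / t := div_pos (by linarith) ht0
        linarith
      refine eventually_elog_muIccE_lt hc (hx.eventually_const_lt (EReal.coe_lt_coe_iff.2 hm))
        (eventually_elog_Ici_lt hc ht0.le (hL ▸ hf) (le_of_eq ?_))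
      field_simp
      ring
    · have hV : rightLimE L 0 - ((0 : ℝ) : EReal) * rightLimE (rightDerivE L) 0 = 0 := by
        rw [show rightLimE L 0 = 0 from hlim.limsup_eq]
        simp
      refine ⟨fun t ht => hK.ne_bot_of_tendsto h0 hlim ht,
        hK.rightDerivAccumulates_of_tendsto h0 hlim hR, fun w hw => ?_, fun w hw => ?_⟩
      · rw [hV] at hw
        exact hK.exists_tilt_of_tendsto h0 hlim hR hts (by exact_mod_cast hw) (hR ▸ hy)
      · rw [hV] at hw
        exact Eventually.of_forall fun i => (elog_le_zero (hc i) _ _).trans_lt hw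
  have hlower : ∀ w : ℝ,
      (w : EReal) < rightLimE L lam - (lam : EReal) * rightLimE (rightDerivE L) lam →
      ∀ᶠ i in lf, (w : EReal) < elog (c i) (muIooE (μ i) (x i) (y i)) := by
    intro w hw
    obtain ⟨n, f, b, hn, hf, hder, hb, hwb⟩ := htilt w hw
    obtain ⟨s, p, hs, hp, hpb⟩ := exists_lt_of_rightDerivE_lt hf hder
    obtain ⟨s', g, m, hs', hg, hm, hgm⟩ := hK.exists_slope_gt hlam h0 hbot hacc hn hf
    obtain ⟨p', hp1, hp2⟩ := exists_between (show g < f - (tseq n - s') * m by linarith)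
    obtain ⟨Li, hLi⟩ := hex n
    have hLf : Li = (f : EReal) := by
      rw [← hf, hL]
      exact hLi.limsup_eq.symm
    have ht0 : 0 ≤ tseq n := hlam.trans ((hK.le_tildeOf hbot hacc).trans hn.le)
    exact eventually_lt_elog_muIooE hc (hx.eventually_lt_const hm) (hybig b hb)
      (eventually_lt_elog_Ioo hc hc0 ht0 (hLf ▸ hLi) hs (hL ▸ hp) hpb hs'
        (by rw [← hL, hg]; exact_mod_cast hp1) (by linarith) hwb)
  constructor
  · refine tendsto_order.2 ⟨fun v hv => ?_, fun v hv => ?_⟩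
    · obtain ⟨w, hvw, hw⟩ := EReal.lt_iff_exists_real_btwn.1 hv
      filter_upwards [hlower w hw] with i hi
      exact (hvw.trans hi).trans_le (elog_mono (hc i) (muIooE_le_muIccE _ _ _))
    · obtain ⟨w, hw, hwv⟩ := EReal.lt_iff_exists_real_btwn.1 hv
      filter_upwards [hupper w hw] with i hi using hi.trans hwv
  · refine tendsto_order.2 ⟨fun v hv => ?_, fun v hv => ?_⟩
    · obtain ⟨w, hvw, hw⟩ := EReal.lt_iff_exists_real_btwn.1 hv
      filter_upwards [hlower w hw] with i hi using hvw.trans hi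
    · obtain ⟨w, hw, hwv⟩ := EReal.lt_iff_exists_real_btwn.1 hv
      filter_upwards [hupper w hw] with i hi
      exact ((elog_mono (hc i) (muIooE_le_muIccE _ _ _)).trans_lt hi).trans hwv
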